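/- For any finite tuple of digits c₁,…,c_{k₀} ∈ {0,1,2} (k₀ ≥ 0), let x₁ = val(c₁,…,c_{k₀}, 2, 0, 0, 0, …) and x₂ = val(c₁,…,c_{k₀}, 0, 1, 1, 1, …). Then x₁ ≠ x₂ but f(x₁) = f(x₂), i.e., val(θ(c₁),…,θ(c_{k₀}), 1, 0, 0, 0, …) = val(θ(c₁),…,θ(c_{k₀}), 0, 2, 2, 2, …). Hence f is not injective. -/

import Mathlib

open Filter MeasureTheory Finset

/-- The "beta" values `β₀ = 0`, `β₁ = p₀`, `β₂ = p₀ + p₁` associated with weights `p`. -/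
noncomputable def P3beta (p : Fin 3 → ℝ) : Fin 3 → ℝ := ![0, p 0, p 0 + p 1]

/-- The P₃-value of a digit sequence `i : ℕ → Fin 3` (0-indexed):
`val(i) = β_{i₀} + Σ_{k≥1} β_{i_k} ∏_{r<k} p_{i_r}`. -/
noncomputable def P3val (p : Fin 3 → ℝ) (i : ℕ → Fin 3) : ℝ :=
  ∑' k : ℕ, P3beta p (i k) * ∏ r ∈ Finset.range k, p (i r)

/-- The digit permutation θ with θ(0)=0, θ(1)=2, θ(2)=1. -/
def P3theta : Fin 3 → Fin 3 := ![0, 2, 1]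

/-- The one-sided shift on digit sequences. -/
def P3shift (i : ℕ → Fin 3) : ℕ → Fin 3 := fun k => i (k + 1)

theorem P3beta_nonneg {p : Fin 3 → ℝ} (hp : ∀ t, 0 < p t) (t : Fin 3) : 0 ≤ P3beta p t := by
  have := hp 0
  have := hp 1
  fin_cases t <;> simp [P3beta] <;> linarith

theorem P3beta_add_le_one {p : Fin 3 → ℝ} (hp : ∀ t, 0 < p t) (hsum : p 0 + p 1 + p 2 = 1)
    (t : Fin 3) : P3beta p t + p t ≤ 1 := by
  have := hp 1
  have := hp 2
  fin_cases t <;> simp [P3beta] <;> linarith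

theorem P3val_term_nonneg {p : Fin 3 → ℝ} (hp : ∀ t, 0 < p t) (i : ℕ → Fin 3) (k : ℕ) :
    0 ≤ P3beta p (i k) * ∏ r ∈ Finset.range k, p (i r) :=
  mul_nonneg (P3beta_nonneg hp _) (Finset.prod_nonneg fun _ _ => (hp _).le)

theorem P3val_partial_sum_add_prod_le_one {p : Fin 3 → ℝ} (hp : ∀ t, 0 < p t)
    (hsum : p 0 + p 1 + p 2 = 1) (i : ℕ → Fin 3) (n : ℕ) :
    ∑ k ∈ Finset.range n, P3beta p (i k) * ∏ r ∈ Finset.range k, p (i r) +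
      ∏ r ∈ Finset.range n, p (i r) ≤ 1 := by
  induction n with
  | zero => simp
  | succ n ih =>
    rw [Finset.sum_range_succ, Finset.prod_range_succ]
    have hP : 0 ≤ ∏ r ∈ Finset.range n, p (i r) := Finset.prod_nonneg fun _ _ => (hp _).le
    nlinarith [mul_le_mul_of_nonneg_right (P3beta_add_le_one hp hsum (i n)) hP]

theorem P3val_partial_sum_le_one {p : Fin 3 → ℝ} (hp : ∀ t, 0 < p t)
    (hsum : p 0 + p 1 + p 2 = 1) (i : ℕ → Fin 3) (n : ℕ) :
    ∑ k ∈ Finset.range n, P3beta p (i k) * ∏ r ∈ Finset.range k, p (i r) ≤ 1 := by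
  have hP : 0 ≤ ∏ r ∈ Finset.range n, p (i r) := Finset.prod_nonneg fun _ _ => (hp _).le
  linarith [P3val_partial_sum_add_prod_le_one hp hsum i n]

theorem P3val_summable {p : Fin 3 → ℝ} (hp : ∀ t, 0 < p t) (hsum : p 0 + p 1 + p 2 = 1)
    (i : ℕ → Fin 3) :
    Summable fun k : ℕ => P3beta p (i k) * ∏ r ∈ Finset.range k, p (i r) :=
  summable_of_sum_range_le (P3val_term_nonneg hp i) (P3val_partial_sum_le_one hp hsum i)

theorem P3val_mem_Icc {p : Fin 3 → ℝ} (hp : ∀ t, 0 < p t) (hsum : p 0 + p 1 + p 2 = 1)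
    (i : ℕ → Fin 3) : P3val p i ∈ Set.Icc (0 : ℝ) 1 :=
  ⟨tsum_nonneg (P3val_term_nonneg hp i),
    Real.tsum_le_of_sum_range_le (P3val_term_nonneg hp i) (P3val_partial_sum_le_one hp hsum i)⟩

/-- Splitting off the first `n` digits of a digit sequence. -/
theorem P3val_split {p : Fin 3 → ℝ} (hp : ∀ t, 0 < p t) (hsum : p 0 + p 1 + p 2 = 1)
    (i : ℕ → Fin 3) (n : ℕ) :
    P3val p i = ∑ k ∈ Finset.range n, P3beta p (i k) * ∏ r ∈ Finset.range k, p (i r) +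
      (∏ r ∈ Finset.range n, p (i r)) * P3val p (fun k => i (n + k)) := by
  rw [P3val, ← (P3val_summable hp hsum i).sum_add_tsum_nat_add n, P3val, ← tsum_mul_left]
  congr 2
  funext k
  rw [add_comm k n, Finset.prod_range_add]
  ring

theorem P3val_const {p : Fin 3 → ℝ} (hp : ∀ t, p t ∈ Set.Ioo (0 : ℝ) 1) (t : Fin 3) :
    P3val p (fun _ => t) = P3beta p t / (1 - p t) := by
  simp only [P3val, Finset.prod_const, Finset.card_range, tsum_mul_left]
  rw [tsum_geometric_of_lt_one (hp t).1.le (hp t).2, div_eq_mul_inv]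

/-- The value of a digit sequence consisting of `k0` digits of `c`, then `a`, then `b` forever. -/
theorem P3val_prefix_digit_const {p : Fin 3 → ℝ} (hp : ∀ t, p t ∈ Set.Ioo (0 : ℝ) 1)
    (hsum : p 0 + p 1 + p 2 = 1) (k0 : ℕ) (c : ℕ → Fin 3) (a b : Fin 3) :
    P3val p (fun k => if k < k0 then c k else if k = k0 then a else b) =
      ∑ k ∈ Finset.range k0, P3beta p (c k) * ∏ r ∈ Finset.range k, p (c r) +
        (∏ r ∈ Finset.range k0, p (c r)) * (P3beta p a + p a * (P3beta p b / (1 - p b))) := by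
  have hp0 : ∀ t, 0 < p t := fun t => (hp t).1
  rw [P3val_split hp0 hsum _ k0]
  congr 1
  · refine Finset.sum_congr rfl fun k hk => ?_
    have hk := Finset.mem_range.1 hk
    rw [if_pos hk]
    congr 1
    refine Finset.prod_congr rfl fun r hr => ?_
    rw [if_pos ((Finset.mem_range.1 hr).trans hk)]
  · congr 1
    · refine Finset.prod_congr rfl fun r hr => ?_
      rw [if_pos (Finset.mem_range.1 hr)]
    · rw [P3val_split hp0 hsum _ 1, ← P3val_const hp b]
      simp

theorem stmt2 (p : Fin 3 → ℝ) (hp : ∀ t, p t ∈ Set.Ioo (0 : ℝ) 1)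
    (hsum : p 0 + p 1 + p 2 = 1)
    (f : ℝ → ℝ)
    (hf : ∀ i : ℕ → Fin 3, (¬ ∃ N, ∀ k ≥ N, i k = 2) →
      f (P3val p i) = P3val p (fun k => P3theta (i k)))
    (k0 : ℕ) (c : ℕ → Fin 3) (i1 i2 : ℕ → Fin 3)
    (h1 : i1 = fun k => if k < k0 then c k else if k = k0 then 2 else 0)
    (h2 : i2 = fun k => if k < k0 then c k else if k = k0 then 0 else 1) :
    P3val p i1 ≠ P3val p i2 ∧
      P3val p (fun k => P3theta (i1 k)) = P3val p (fun k => P3theta (i2 k)) ∧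
      f (P3val p i1) = f (P3val p i2) ∧
      ¬ Set.InjOn f (Set.Icc 0 1) := by
  have hp0 : ∀ t, 0 < p t := fun t => (hp t).1
  have ht (a b : Fin 3) :
      (fun k => P3theta (if k < k0 then c k else if k = k0 then a else b)) =
        fun k => if k < k0 then P3theta (c k) else if k = k0 then P3theta a else P3theta b := by
    funext k
    split_ifs <;> rfl
  have hne : P3val p i1 ≠ P3val p i2 := by
    rw [h1, h2, P3val_prefix_digit_const hp hsum, P3val_prefix_digit_const hp hsum]
    have hP : (∏ r ∈ Finset.range k0, p (c r)) ≠ 0 :=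
      Finset.prod_ne_zero_iff.2 fun _ _ => (hp0 _).ne'
    intro h
    have h := mul_left_cancel₀ hP (add_left_cancel h)
    have hlt : p 0 / (1 - p 1) < 1 := by
      rw [div_lt_one (by linarith [(hp 1).2])]
      linarith [hp0 2]
    simp [P3beta] at h
    nlinarith [hp0 0, hp0 1]
  have hθ : P3val p (fun k => P3theta (i1 k)) = P3val p (fun k => P3theta (i2 k)) := by
    simp only [h1, h2, ht]
    rw [P3val_prefix_digit_const hp hsum k0 (fun k => P3theta (c k)),
      P3val_prefix_digit_const hp hsum k0 (fun k => P3theta (c k))]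
    have h : (p 0 + p 1) / (1 - p 2) = 1 := by
      rw [div_eq_one_iff_eq (by linarith [(hp 2).2])]
      linarith
    simp [P3beta, P3theta, h]
  have hf12 : f (P3val p i1) = f (P3val p i2) := by
    rw [hf i1, hf i2, hθ]
    · rintro ⟨N, hN⟩
      have h := hN (N + k0 + 1) (by omega)
      rw [h2] at h
      simp [show ¬ N + k0 + 1 < k0 by omega, show N + k0 + 1 ≠ k0 by omega] at h
    · rintro ⟨N, hN⟩
      have h := hN (N + k0 + 1) (by omega)
      rw [h1] at h
      simp [show ¬ N + k0 + 1 < k0 by omega, show N + k0 + 1 ≠ k0 by omega] at h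
  exact ⟨hne, hθ, hf12, fun hinj =>
    hne (hinj (P3val_mem_Icc hp0 hsum i1) (P3val_mem_Icc hp0 hsum i2) hf12)⟩
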